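/- Let G be a group, (Π,V) a finite-length representation, τ an irreducible subquotient of multiplicity one, and (U,W), (U',W') two pairs of stable subspaces with U/W ≅ τ ≅ U'/W' and U maximal. Then the inclusion U' ⊆ U induces an isomorphism of representations U'/W' ≅ U/W; more precisely, the natural map U'/W' → U/W (well-defined since W' = W ∩ U') is an isomorphism of G-modules. -/

import Mathlib

/-- The subquotient module `U / W` (more precisely `U / (W ∩ U)`) associated to a pair of
submodules of `V`. -/
abbrev SubQuot (R : Type*) [Ring R] {V : Type*} [AddCommGroup V] [Module R V]
    (W U : Submodule R V) :=
  ↥U ⧸ Submodule.comap U.subtype W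

/-- `s` is a composition series of the module `V`. -/
def IsCompSeries (R : Type*) [Ring R] {V : Type*} [AddCommGroup V] [Module R V] {k : ℕ}
    (s : Fin (k + 1) → Submodule R V) : Prop :=
  s 0 = ⊥ ∧ s (Fin.last k) = ⊤ ∧
    ∀ i : Fin k, s i.castSucc ≤ s i.succ ∧
      IsSimpleModule R (SubQuot R (s i.castSucc) (s i.succ))

/-- `τ` occurs with multiplicity one among the Jordan–Hölder factors of `V`. -/
def MultOne (R : Type*) [Ring R] (V : Type*) [AddCommGroup V] [Module R V]
    (τ : Type*) [AddCommGroup τ] [Module R τ] : Prop :=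
  ∀ (k : ℕ) (s : Fin (k + 1) → Submodule R V), IsCompSeries R s →
    ∃! i : Fin k, Nonempty (SubQuot R (s i.castSucc) (s i.succ) ≃ₗ[R] τ)

/-- Two covers in a chain are consecutive terms of a common maximal chain from `⊥` to `⊤`. -/
theorem exists_covBy_seq_through_two_covBy {α : Type*} [PartialOrder α] [BoundedOrder α]
    [WellFoundedLT α] [WellFoundedGT α] {a b c d : α} (hab : a ⋖ b) (hbc : b ≤ c) (hcd : c ⋖ d) :
    ∃ (h : ℕ → α) (n i j : ℕ), h 0 = ⊥ ∧ h n = ⊤ ∧ (∀ k < n, h k ⋖ h (k + 1)) ∧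
      i < j ∧ j < n ∧ h i = a ∧ h (i + 1) = b ∧ h j = c ∧ h (j + 1) = d := by
  obtain ⟨f, f0, n, fn, hf⟩ :=
    exists_covBy_seq_of_wellFoundedLT_wellFoundedGT_of_le (bot_le : ⊥ ≤ a)
  obtain ⟨g, g0, m, gm, hg⟩ := exists_covBy_seq_of_wellFoundedLT_wellFoundedGT_of_le hbc
  obtain ⟨k, k0, l, kl, hk⟩ :=
    exists_covBy_seq_of_wellFoundedLT_wellFoundedGT_of_le (le_top : d ≤ ⊤)
  let h : ℕ → α := fun i =>
    if i ≤ n then f i else if i ≤ n + 1 + m then g (i - (n + 1)) else k (i - (n + m + 2))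
  have h₁ (i : ℕ) (hi : i ≤ n) : h i = f i := if_pos hi
  have h₂ (i : ℕ) (hi : i ≤ m) : h (n + 1 + i) = g i := by
    simp only [h]
    rw [if_neg (by omega), if_pos (by omega), Nat.add_sub_cancel_left]
  have h₃ (i : ℕ) : h (n + m + 2 + i) = k i := by
    simp only [h]
    rw [if_neg (by omega), if_neg (by omega), Nat.add_sub_cancel_left]
  have hb : h (n + 1) = b := (h₂ 0 (Nat.zero_le _)).trans g0
  have hc : h (n + 1 + m) = c := (h₂ m le_rfl).trans gm
  have hd : h (n + 1 + m + 1) = d := by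
    rw [show n + 1 + m + 1 = n + m + 2 + 0 by omega, h₃, k0]
  have ha : h n = a := (h₁ n le_rfl).trans fn
  refine ⟨h, n + m + 2 + l, n, n + 1 + m, (h₁ 0 (Nat.zero_le _)).trans f0, (h₃ l).trans kl, ?_,
    by omega, by omega, ha, hb, hc, hd⟩
  intro i hi
  rcases lt_trichotomy i n with hin | rfl | hin
  · rw [h₁ i hin.le, h₁ (i + 1) hin]
    exact hf i hin
  · rwa [ha, hb]
  obtain ⟨p, rfl⟩ := Nat.exists_eq_add_of_le (Nat.succ_le_of_lt hin)
  rcases lt_trichotomy p m with hpm | rfl | hpm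
  · change h (n + 1 + p) ⋖ h (n + 1 + (p + 1))
    rw [h₂ p hpm.le, h₂ (p + 1) hpm]
    exact hg p hpm
  · change h (n + 1 + p) ⋖ h (n + 1 + p + 1)
    rwa [hc, hd]
  obtain ⟨q, rfl⟩ := Nat.exists_eq_add_of_le (Nat.succ_le_of_lt hpm)
  rw [show n.succ + (m.succ + q) + 1 = n + m + 2 + (q + 1) by omega,
    show n.succ + (m.succ + q) = n + m + 2 + q by omega, h₃, h₃]
  exact hk q (by omega)

section

variable {R : Type*} [Ring R] {V : Type*} [AddCommGroup V] [Module R V]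
  {τ : Type*} [AddCommGroup τ] [Module R τ]

/-- A pair of submodules whose subquotient is simple is a cover. -/
theorem SubQuot.covBy_of_equiv (hτ : IsSimpleModule R τ) {A B : Submodule R V} (hAB : A ≤ B)
    (e : Nonempty (SubQuot R A B ≃ₗ[R] τ)) : A ⋖ B :=
  (covBy_iff_quot_is_simple hAB).2 (IsSimpleModule.congr e.some)

/-- The second isomorphism theorem for subquotients. -/
theorem SubQuot.nonempty_inf_equiv_iff (X Y : Submodule R V) :
    Nonempty (SubQuot R (Y ⊓ X) Y ≃ₗ[R] τ) ↔ Nonempty (SubQuot R X (Y ⊔ X) ≃ₗ[R] τ) := by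
  have e₀ := LinearMap.quotientInfEquivSupQuotient Y X
  have e : SubQuot R (Y ⊓ X) Y ≃ₗ[R] SubQuot R X (Y ⊔ X) :=
    (Submodule.quotEquivOfEq _ _ (Submodule.comap_inf _ _ _)).trans e₀
  exact ⟨fun h => ⟨e.symm.trans h.some⟩, fun h => ⟨e.trans h.some⟩⟩

/-- A simple module of multiplicity one does not occur at two levels of a chain. -/
theorem MultOne.false_of_chain (hfl : IsFiniteLength R V) (hτ : IsSimpleModule R τ)
    (hmult : MultOne R V τ) {A B C D : Submodule R V}
    (hAB : A ≤ B) (e₁ : Nonempty (SubQuot R A B ≃ₗ[R] τ)) (hBC : B ≤ C)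
    (hCD : C ≤ D) (e₂ : Nonempty (SubQuot R C D ≃ₗ[R] τ)) : False := by
  obtain ⟨_, _⟩ := isFiniteLength_iff_isNoetherian_isArtinian.1 hfl
  obtain ⟨h, n, i, j, h0, hn, hcov, hij, hj, rfl, rfl, rfl, rfl⟩ :=
    exists_covBy_seq_through_two_covBy (SubQuot.covBy_of_equiv hτ hAB e₁) hBC
      (SubQuot.covBy_of_equiv hτ hCD e₂)
  have hs : IsCompSeries R (fun k : Fin (n + 1) => h k) :=
    ⟨h0, hn, fun k => ⟨(hcov k k.2).le, (covBy_iff_quot_is_simple (hcov k k.2).le).1 (hcov k k.2)⟩⟩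
  have heq := (hmult n _ hs).unique (y₁ := ⟨i, hij.trans hj⟩) (y₂ := ⟨j, hj⟩) e₁ e₂
  exact hij.ne (congrArg Fin.val heq)

/-- If `U / W` and `U' / W'` are both the simple module of multiplicity one, then `W ⊔ W'`
does not contain `U`. -/
theorem MultOne.not_le_sup (hfl : IsFiniteLength R V) (hτ : IsSimpleModule R τ)
    (hmult : MultOne R V τ) {U W U' W' : Submodule R V}
    (hWU : W ≤ U) (hiso : Nonempty (SubQuot R W U ≃ₗ[R] τ))
    (hWU' : W' ≤ U') (hiso' : Nonempty (SubQuot R W' U' ≃ₗ[R] τ)) : ¬ U ≤ W ⊔ W' := by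
  intro hle
  have hU : W' ⊓ U ⊔ W = U := by
    rw [sup_comm, ← sup_inf_assoc_of_le W' hWU, inf_eq_right.2 hle]
  refine hmult.false_of_chain hfl hτ (inf_le_left : W' ⊓ U ⊓ W ≤ _) ?_ inf_le_left hWU' hiso'
  rw [SubQuot.nonempty_inf_equiv_iff, hU]
  exact hiso

/-- If `U / W` is simple and `X` contains `W` but not `U`, then `(U ⊔ X) / X ≅ U / W`. -/
theorem SubQuot.nonempty_sup_equiv (hτ : IsSimpleModule R τ) {U W X : Submodule R V}
    (hWU : W ≤ U) (hiso : Nonempty (SubQuot R W U ≃ₗ[R] τ)) (hWX : W ≤ X) (hUX : ¬ U ≤ X) :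
    Nonempty (SubQuot R X (U ⊔ X) ≃ₗ[R] τ) := by
  rw [← SubQuot.nonempty_inf_equiv_iff]
  have hinf : U ⊓ X = W :=
    ((SubQuot.covBy_of_equiv hτ hWU hiso).eq_or_eq (le_inf hWU hWX) inf_le_left).resolve_right
      (fun h => hUX (inf_eq_left.1 h))
  rwa [hinf]

end

theorem statement3 {R : Type*} [Ring R] {V : Type*} [AddCommGroup V] [Module R V]
    (hfl : IsFiniteLength R V)
    {τ : Type*} [AddCommGroup τ] [Module R τ] (hτ : IsSimpleModule R τ)
    (hmult : MultOne R V τ)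
    (U W U' W' : Submodule R V)
    (hWU : W ≤ U) (hiso : Nonempty (SubQuot R W U ≃ₗ[R] τ))
    (hWU' : W' ≤ U') (hiso' : Nonempty (SubQuot R W' U' ≃ₗ[R] τ))
    (hmax : ∀ U₁ W₁ : Submodule R V, W₁ ≤ U₁ →
      Nonempty (SubQuot R W₁ U₁ ≃ₗ[R] τ) → U ≤ U₁ → U₁ = U) :
    ∃ hle : U' ≤ U,
      ∃ hker : Submodule.comap U'.subtype W' ≤
          LinearMap.ker ((Submodule.comap U.subtype W).mkQ ∘ₗ Submodule.inclusion hle),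
        Function.Bijective
          (Submodule.liftQ (Submodule.comap U'.subtype W')
            ((Submodule.comap U.subtype W).mkQ ∘ₗ Submodule.inclusion hle) hker) := by
  have hnot := hmult.not_le_sup hfl hτ hWU hiso hWU' hiso'
  have hnot' := hmult.not_le_sup hfl hτ hWU' hiso' hWU hiso
  have hcov := SubQuot.covBy_of_equiv hτ hWU hiso
  have hcov' := SubQuot.covBy_of_equiv hτ hWU' hiso'
  have hsup : U ⊔ (W ⊔ W') = U := hmax _ (W ⊔ W') le_sup_right
    (SubQuot.nonempty_sup_equiv hτ hWU hiso le_sup_left hnot) le_sup_left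
  have hW'W : W' ≤ W := by
    have h : W ⊔ W' = W := (hcov.eq_or_eq le_sup_left (sup_eq_left.1 hsup)).resolve_right
      (fun h => hnot h.ge)
    exact sup_eq_left.1 h
  have hU'W : ¬ U' ≤ W := fun h => hnot' (h.trans le_sup_right)
  have hle : U' ≤ U := by
    by_contra hU'U
    have e' := SubQuot.nonempty_sup_equiv hτ hWU' hiso' hW'W hU'W
    by_cases hUX : U ≤ U' ⊔ W
    · rcases (SubQuot.covBy_of_equiv hτ le_sup_right e').eq_or_eq hWU hUX with h | h
      · exact hcov.ne h.symm
      · exact hU'U (le_sup_left.trans h.ge)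
    · exact hmult.false_of_chain hfl hτ le_sup_right e' le_rfl le_sup_right
        (SubQuot.nonempty_sup_equiv hτ hWU hiso le_sup_right hUX)
  have hinf : U' ⊓ W = W' :=
    (hcov'.eq_or_eq (le_inf hWU' hW'W) inf_le_left).resolve_right
      (fun h => hU'W (inf_eq_left.1 h))
  have hUW : U' ⊔ W = U :=
    (hcov.eq_or_eq le_sup_right (sup_le hle hWU)).resolve_left
      (fun h => hU'W (sup_eq_right.1 h))
  refine ⟨hle, ?_, ?_, ?_⟩
  · intro x hx
    simpa using hW'W hx
  · rw [← LinearMap.ker_eq_bot, Submodule.ker_liftQ_eq_bot]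
    intro x hx
    have hxW : (x : V) ∈ W := by simpa using hx
    exact hinf.le ⟨x.2, hxW⟩
  · intro y
    obtain ⟨⟨u, hu⟩, rfl⟩ := Submodule.mkQ_surjective _ y
    obtain ⟨a, ha, w, hw, rfl⟩ := Submodule.mem_sup.1 (hUW.ge hu)
    refine ⟨Submodule.Quotient.mk ⟨a, ha⟩, ?_⟩
    rw [Submodule.liftQ_apply]
    refine (Submodule.Quotient.eq _).2 ?_
    simpa using hw
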